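/- Discrete entropy conservation of the split-form Burgers volume term: let N ≥ 1 and let Q be an SBP matrix with zero row sums. Then for every U_0, …, U_N ∈ ℝ, Σ_{i=0}^N Σ_{m=0}^N U_i · Q_{im} · (1/3)·(U_i² + U_i U_m + U_m²) = (U_N³ − U_0³)/3, i.e. testing the entropy conservative Burgers volume term with the entropy variable W = U yields exactly the boundary difference of the entropy flux f^{ent}(u) = u³/3. -/

import Mathlib

open Matrix

/-- The SBP boundary matrix `B = diag(−1, 0, …, 0, 1)`. -/
def sbpBoundaryMatrix (N : ℕ) : Matrix (Fin (N + 1)) (Fin (N + 1)) ℝ :=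
  Matrix.of fun i j =>
    if i = j then (if (i : ℕ) = 0 then -1 else if (i : ℕ) = N then 1 else 0) else 0

/-- Summing against the boundary matrix evaluates the difference of the two corner entries. -/
theorem sum_sbpBoundaryMatrix_mul {N : ℕ} (hN : 1 ≤ N) (f : Fin (N + 1) → Fin (N + 1) → ℝ) :
    ∑ i, ∑ m, sbpBoundaryMatrix N i m * f i m = f (Fin.last N) (Fin.last N) - f 0 0 := by
  obtain ⟨n, rfl⟩ : ∃ n, N = n + 1 := ⟨N - 1, by omega⟩
  have hdiag (i : Fin (n + 1 + 1)) : ∑ m, sbpBoundaryMatrix (n + 1) i m * f i m =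
      (if i = Fin.last (n + 1) then f i i else 0) - (if i = 0 then f i i else 0) := by
    rw [Finset.sum_eq_single i (fun m _ hm => by simp [sbpBoundaryMatrix, hm.symm]) (by simp)]
    have hzero : i = 0 ↔ (i : ℕ) = 0 := Fin.ext_iff
    have hlast : i = Fin.last (n + 1) ↔ (i : ℕ) = n + 1 := Fin.ext_iff
    simp only [sbpBoundaryMatrix, Matrix.of_apply, hzero, hlast, if_true]
    split_ifs <;> first | omega | ring
  simp [hdiag, Finset.sum_sub_distrib]

/-- Only the symmetric part of a matrix contributes to its pairing with a symmetric kernel. -/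
theorem two_mul_sum_mul_of_symmetric {ι : Type*} [Fintype ι] (Q : Matrix ι ι ℝ)
    (f : ι → ι → ℝ) (hf : ∀ i m, f i m = f m i) :
    2 * ∑ i, ∑ m, Q i m * f i m = ∑ i, ∑ m, (Q + Qᵀ) i m * f i m := by
  have hswap : ∑ i, ∑ m, Q m i * f i m = ∑ i, ∑ m, Q i m * f i m := by
    rw [Finset.sum_comm]
    exact Finset.sum_congr rfl fun i _ => Finset.sum_congr rfl fun m _ => by rw [hf]
  simp only [Matrix.add_apply, Matrix.transpose_apply, add_mul, Finset.sum_add_distrib, hswap]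
  ring

/-- Discrete entropy conservation of the split-form Burgers volume term: testing the
entropy conservative Burgers volume term with the entropy variable `W = U` yields
exactly the boundary difference of the entropy flux `u³/3`. -/
theorem burgers_split_form_entropy_conservation (N : ℕ) (hN : 1 ≤ N)
    (Q : Matrix (Fin (N + 1)) (Fin (N + 1)) ℝ)
    (hSBP : Q + Qᵀ = sbpBoundaryMatrix N)
    (hrow : ∀ i, ∑ m, Q i m = 0)
    (U : Fin (N + 1) → ℝ) :
    ∑ i, ∑ m, U i * Q i m * ((1 / 3 : ℝ) * (U i ^ 2 + U i * U m + U m ^ 2))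
      = (U (Fin.last N) ^ 3 - U 0 ^ 3) / 3 := by
  have hcube : ∑ i, ∑ m, Q i m * U i ^ 3 = 0 := by
    simp [← Finset.sum_mul, hrow]
  have hsymm := two_mul_sum_mul_of_symmetric Q (fun i m => U i ^ 2 * U m + U i * U m ^ 2)
    fun i m => by ring
  rw [hSBP, sum_sbpBoundaryMatrix_mul hN] at hsymm
  have hsplit : ∑ i, ∑ m, U i * Q i m * ((1 / 3 : ℝ) * (U i ^ 2 + U i * U m + U m ^ 2)) =
      (1 / 3 : ℝ) * (∑ i, ∑ m, Q i m * U i ^ 3 +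
        ∑ i, ∑ m, Q i m * (U i ^ 2 * U m + U i * U m ^ 2)) := by
    simp only [← Finset.sum_add_distrib, Finset.mul_sum]
    exact Finset.sum_congr rfl fun i _ => Finset.sum_congr rfl fun m _ => by ring
  rw [hsplit, hcube]
  linarith
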